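/- For integers 2 < m ≤ n+1, the number of (m−2)-metered (m,n)-parking functions is mpf_{m,n}(m−2) = (n−m+2)²(m−1)^{m−3} + Σ_{k=n−m+3}^{n} C(m−2, n−k)(n−k+1)^{n−k−1} [ C(k+1, 2)(n−m+2) k^{m−n+k−3} + ( k(n−m+1) − C(n−m+2, 2) )(k−n+m−1)^{k−n+m−3} + Σ_{j=n−m+2}^{k−1} ( jk − C(j+1, 2) ) C(m−2−n+k, k−1−j)(n−m+1) j^{j+m−2−n} (k−j)^{k−j−2} ]. Here C(a,b) denotes the binomial coefficient, and a power of the form 1^{−1} (which occurs only in the factor (n−k+1)^{n−k−1} when k = n, and in the factor (k−j)^{k−j−2} when j = k−1) is interpreted as 1. -/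

import Mathlib

/-- One step of the `t`-metered parking process on spots `1,…,n`:
given the outcome list `prev` for the cars that have already entered
(`prev[j-1] = some s` if car `j` parked in spot `s`, `none` if it failed to park),
compute the outcome list after the next car (with preference `pref`) tries to park.
When the next car enters, the occupied spots are exactly the spots of the previous
`t` cars that are still on the street (all earlier cars have already left), and the
entering car parks in the smallest unoccupied spot `≥ pref` among `1,…,n`, if any. -/
def parkStep (n t : ℕ) (prev : List (Option ℕ)) (pref : ℕ) : List (Option ℕ) :=
  let occ : List ℕ := (prev.drop (prev.length - t)).filterMap id
  prev ++ [((List.range' pref (n + 1 - pref)).filter (fun s => decide (s ∉ occ))).head?]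

/-- The outcome of the `t`-metered parking process on spots `1,…,n` for the
preference list `l` (car `i` prefers spot `l[i-1]`); the `i`-th entry is
`some s` if car `i` parks in spot `s`, and `none` if car `i` fails to park. -/
def parkOutcome (n t : ℕ) (l : List ℕ) : List (Option ℕ) :=
  l.foldl (parkStep n t) []

/-- `l` is a `t`-metered `(m,n)`-parking function: a preference list in `[n]^m`
under which every car parks in the `t`-metered parking scheme. -/
def MeteredPF (m n t : ℕ) (l : List ℕ) : Prop :=
  l.length = m ∧ (∀ x ∈ l, x ∈ Finset.Icc 1 n) ∧
    ∀ o ∈ parkOutcome n t l, o.isSome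

/-- `l` is a classical `(m,n)`-parking function: a preference list in `[n]^m` under
which every car parks when no car ever leaves (equivalently, the `t`-metered scheme
with `t = m`, under which no car leaves while cars are still arriving). -/
def ParkingFunction (m n : ℕ) (l : List ℕ) : Prop :=
  l.length = m ∧ (∀ x ∈ l, x ∈ Finset.Icc 1 n) ∧
    ∀ o ∈ parkOutcome n m l, o.isSome

/-- The first spot numbered at least `a` that is not in `B`. -/
noncomputable def nextFree (B : Finset ℕ) (a : ℕ) : ℕ := sInf {x | a ≤ x ∧ x ∉ B}

theorem nextFree_mem (B : Finset ℕ) (a : ℕ) : a ≤ nextFree B a ∧ nextFree B a ∉ B := by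
  refine Nat.sInf_mem (s := {x | a ≤ x ∧ x ∉ B}) ?_
  obtain ⟨x, hx⟩ := Infinite.exists_notMem_finset (B ∪ Finset.range a)
  simp only [Finset.mem_union, Finset.mem_range, not_or, not_lt] at hx
  exact ⟨x, hx.2, hx.1⟩

theorem le_nextFree (B : Finset ℕ) (a : ℕ) : a ≤ nextFree B a := (nextFree_mem B a).1

theorem nextFree_notMem (B : Finset ℕ) (a : ℕ) : nextFree B a ∉ B := (nextFree_mem B a).2

theorem nextFree_le {B : Finset ℕ} {a x : ℕ} (h : a ≤ x) (hx : x ∉ B) : nextFree B a ≤ x :=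
  Nat.sInf_le ⟨h, hx⟩

theorem mem_of_lt_nextFree {B : Finset ℕ} {a x : ℕ} (h : a ≤ x) (hx : x < nextFree B a) :
    x ∈ B := by
  by_contra hB
  exact absurd (nextFree_le h hB) (not_le.mpr hx)

theorem nextFree_eq {B : Finset ℕ} {a x : ℕ} (h : a ≤ x) (hx : x ∉ B)
    (hB : ∀ y, a ≤ y → y < x → y ∈ B) : nextFree B a = x := by
  refine le_antisymm (nextFree_le h hx) ?_
  by_contra! hlt
  exact nextFree_notMem B a (hB _ (le_nextFree B a) hlt)

theorem nextFree_insert_of_ne {B : Finset ℕ} {a x : ℕ} (h : nextFree B a ≠ x) :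
    nextFree (insert x B) a = nextFree B a :=
  nextFree_eq (le_nextFree B a) (by simp [h, nextFree_notMem])
    fun _ h1 h2 => Finset.mem_insert_of_mem (mem_of_lt_nextFree h1 h2)

theorem nextFree_insert_self (B : Finset ℕ) (a : ℕ) :
    nextFree (insert (nextFree B a) B) a = nextFree B (nextFree B a + 1) := by
  have h1 := le_nextFree B a
  have h2 := le_nextFree B (nextFree B a + 1)
  refine nextFree_eq (by omega) ?_ fun y hy hy' => ?_
  · simp only [Finset.mem_insert, nextFree_notMem, or_false]
    omega
  · rcases lt_trichotomy y (nextFree B a) with h | h | h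
    · exact Finset.mem_insert_of_mem (mem_of_lt_nextFree hy h)
    · simp [h]
    · exact Finset.mem_insert_of_mem (mem_of_lt_nextFree h hy')

/-- The occupied spots after one more car, with preference `a`, has parked. -/
noncomputable def parkIn (a : ℕ) (B : Finset ℕ) : Finset ℕ := insert (nextFree B a) B

theorem parkIn_left_comm (a b : ℕ) (B : Finset ℕ) :
    parkIn a (parkIn b B) = parkIn b (parkIn a B) := by
  unfold parkIn
  by_cases h : nextFree B a = nextFree B b
  · have ha := nextFree_insert_self B a
    have hb := nextFree_insert_self B b
    rw [← h] at hb ⊢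
    rw [ha, hb]
  · rw [nextFree_insert_of_ne h, nextFree_insert_of_ne (Ne.symm h), Finset.insert_comm]

/-- The set of spots occupied on an infinite street after the cars in `l` have parked. -/
noncomputable def occupied (l : List ℕ) : Finset ℕ := l.foldr parkIn ∅

@[simp] theorem occupied_nil : occupied [] = ∅ := rfl

theorem occupied_cons (a : ℕ) (l : List ℕ) :
    occupied (a :: l) = insert (nextFree (occupied l) a) (occupied l) := rfl

theorem occupied_perm {l l' : List ℕ} (h : l.Perm l') : occupied l = occupied l' :=
  haveI : LeftCommutative parkIn := ⟨parkIn_left_comm⟩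
  h.foldr_eq _

theorem occupied_concat (l : List ℕ) (a : ℕ) :
    occupied (l ++ [a]) = insert (nextFree (occupied l) a) (occupied l) := by
  rw [← occupied_cons]
  exact occupied_perm (List.perm_append_singleton a l)

theorem subset_occupied_append (l l' : List ℕ) : occupied l ⊆ occupied (l' ++ l) := by
  induction l' with
  | nil => simp
  | cons a l' ih => exact ih.trans (Finset.subset_insert _ _)

theorem occupied_filter_subset (p : ℕ → Bool) (l : List ℕ) :
    occupied (l.filter p) ⊆ occupied l := by
  rw [← occupied_perm ((List.perm_append_comm).trans (List.filter_append_perm p l))]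
  exact subset_occupied_append _ _

theorem card_occupied (l : List ℕ) : (occupied l).card = l.length := by
  induction l with
  | nil => rfl
  | cons a l ih => rw [occupied_cons, Finset.card_insert_of_notMem (nextFree_notMem _ _), ih]; rfl

theorem exists_mem_Icc_subset_occupied {l : List ℕ} {x : ℕ} (h : x ∈ occupied l) :
    ∃ a ∈ l, a ≤ x ∧ Finset.Icc a x ⊆ occupied l := by
  induction l with
  | nil => simp at h
  | cons b l ih =>
    rw [occupied_cons, Finset.mem_insert] at h
    rcases h with h | h
    · refine ⟨b, by simp, h ▸ le_nextFree _ _, fun y hy => ?_⟩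
      rw [Finset.mem_Icc] at hy
      rw [occupied_cons, Finset.mem_insert]
      rcases hy.2.eq_or_lt with h' | h'
      · exact Or.inl (h'.trans h)
      · exact Or.inr (mem_of_lt_nextFree hy.1 (h ▸ h'))
    · obtain ⟨a, ha, hax, hs⟩ := ih h
      exact ⟨a, by simp [ha], hax, hs.trans (Finset.subset_insert _ _)⟩

/-- The words of length `i` with letters in `U`. -/
def words (U : Finset ℕ) : ℕ → Finset (List ℕ)
  | 0 => {[]}
  | i + 1 => U.biUnion fun u => (words U i).image (List.cons u)

theorem mem_words {U : Finset ℕ} {i : ℕ} {l : List ℕ} :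
    l ∈ words U i ↔ l.length = i ∧ ∀ x ∈ l, x ∈ U := by
  induction i generalizing l with
  | zero => cases l <;> simp [words]
  | succ i ih =>
    cases l with
    | nil => simp [words]
    | cons a l => simp [words, ih]; tauto

theorem sum_words_succ {β : Type*} [AddCommMonoid β] (U : Finset ℕ) (i : ℕ) (w : List ℕ → β) :
    ∑ l ∈ words U (i + 1), w l = ∑ u ∈ U, ∑ l ∈ words U i, w (u :: l) := by
  rw [words, Finset.sum_biUnion]
  · refine Finset.sum_congr rfl fun u _ => Finset.sum_image fun _ _ _ _ h => ?_
    exact (List.cons.inj h).2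
  · intro u _ v _ huv
    simp only [Function.onFun, Finset.disjoint_left, Finset.mem_image]
    rintro _ ⟨l, _, rfl⟩ ⟨l', _, h⟩
    exact huv (List.cons.inj h).1.symm

theorem sum_words_concat {β : Type*} [AddCommMonoid β] (U : Finset ℕ) (i : ℕ) (w : List ℕ → β) :
    ∑ l ∈ words U (i + 1), w l = ∑ l ∈ words U i, ∑ u ∈ U, w (l ++ [u]) := by
  induction i generalizing w with
  | zero => rw [sum_words_succ]; simp [words]
  | succ i ih =>
    rw [sum_words_succ, sum_words_succ]
    exact Finset.sum_congr rfl fun u _ => ih _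

theorem sum_words_shuffle {U V : Finset ℕ} (h : Disjoint U V) (N i : ℕ) (f g : List ℕ → ℕ) :
    (∑ l ∈ words (U ∪ V) N, if (l.filter (· ∈ U)).length = i then
      f (l.filter (· ∈ U)) * g (l.filter (· ∉ U)) else 0) =
      N.choose i * (∑ l ∈ words U i, f l) * ∑ l ∈ words V (N - i), g l := by
  induction N generalizing i f g with
  | zero => cases i <;> simp [words]
  | succ N ih =>
    rw [sum_words_succ, Finset.sum_union h]
    have hV : (∑ v ∈ V, ∑ l ∈ words (U ∪ V) N, if ((v :: l).filter (· ∈ U)).length = i then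
        f ((v :: l).filter (· ∈ U)) * g ((v :: l).filter (· ∉ U)) else 0) =
        N.choose i * (∑ l ∈ words U i, f l) * ∑ l ∈ words V (N + 1 - i), g l := by
      rcases lt_or_ge N i with hi | hi
      · rw [Nat.choose_eq_zero_of_lt hi, zero_mul, zero_mul]
        refine Finset.sum_eq_zero fun v hv => Finset.sum_eq_zero fun l hl => if_neg ?_
        rw [List.filter_cons_of_neg (by simpa using Finset.disjoint_right.mp h hv)]
        have := List.length_filter_le (· ∈ U) l
        rw [(mem_words.mp hl).1] at this
        omega
      · rw [Nat.sub_add_comm hi, sum_words_succ, Finset.mul_sum]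
        refine Finset.sum_congr rfl fun v hv => ?_
        rw [← ih]
        have hvU := Finset.disjoint_right.mp h hv
        simp [hvU]
    rw [hV]
    cases i with
    | zero => simp +contextual
    | succ i =>
      have hU : (∑ u ∈ U, ∑ l ∈ words (U ∪ V) N, if ((u :: l).filter (· ∈ U)).length = i + 1 then
          f ((u :: l).filter (· ∈ U)) * g ((u :: l).filter (· ∉ U)) else 0) =
          N.choose i * (∑ l ∈ words U (i + 1), f l) * ∑ l ∈ words V (N - i), g l := by
        rw [sum_words_succ, mul_assoc, Finset.sum_mul, Finset.mul_sum]
        refine Finset.sum_congr rfl fun u hu => ?_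
        rw [← mul_assoc, ← ih i (fun l => f (u :: l))]
        simp [hu]
      rw [hU, Nat.choose_succ_succ, Nat.add_sub_add_right]
      ring

theorem words_mono {U V : Finset ℕ} (h : U ⊆ V) (i : ℕ) : words U i ⊆ words V i := fun l hl => by
  rw [mem_words] at hl ⊢
  exact ⟨hl.1, fun x hx => h (hl.2 x hx)⟩

theorem lt_of_mem_occupied {l : List ℕ} {c x : ℕ} (hl : ∀ a ∈ l, c < a) (hx : x ∈ occupied l) :
    c < x := by
  obtain ⟨a, ha, hax, -⟩ := exists_mem_Icc_subset_occupied hx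
  exact (hl a ha).trans_le hax

theorem lt_of_mem_occupied_of_notMem {l : List ℕ} {k x : ℕ} (hl : ∀ a ∈ l, a < k)
    (hk : k ∉ occupied l) (hx : x ∈ occupied l) : x < k := by
  obtain ⟨a, ha, hax, hs⟩ := exists_mem_Icc_subset_occupied hx
  by_contra! h
  exact hk (hs (Finset.mem_Icc.mpr ⟨(hl a ha).le, h⟩))

theorem mem_occupied_of_mem {l : List ℕ} {a : ℕ} (h : a ∈ l) : a ∈ occupied l := by
  rw [occupied_perm (List.perm_cons_erase h), occupied_cons, Finset.mem_insert]
  by_cases ha : a ∈ occupied (l.erase a)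
  · exact Or.inr ha
  · exact Or.inl (nextFree_eq le_rfl ha (by omega)).symm

theorem occupied_eq_union {l : List ℕ} {k : ℕ} (hk : k ∉ l)
    (h : k ∉ occupied (l.filter (¬ k < ·))) :
    occupied l = occupied (l.filter (k < ·)) ∪ occupied (l.filter (¬ k < ·)) := by
  induction l with
  | nil => simp
  | cons a l ih =>
    rw [List.mem_cons, not_or] at hk
    have hlt : ∀ {l' : List ℕ}, k ∉ l' → ∀ a ∈ l'.filter (¬ k < ·), a < k := by
      intro l' hl' a ha
      simp only [List.mem_filter, decide_not, Bool.not_eq_true', decide_eq_false_iff_not] at ha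
      have : a ≠ k := fun e => hl' (e ▸ ha.1)
      omega
    have hhi : ∀ x ∈ occupied (l.filter (k < ·)), k < x := fun x hx =>
      lt_of_mem_occupied (fun a ha => by simpa using (List.mem_filter.mp ha).2) hx
    rcases lt_or_ge k a with hka | hka
    · rw [List.filter_cons_of_neg (by simpa using hka)] at h
      rw [List.filter_cons_of_neg (p := fun x => decide (¬ k < x)) (by simpa using hka),
        List.filter_cons_of_pos (by simpa using hka), occupied_cons, occupied_cons, ih hk.2 h,
        Finset.insert_union]
      congr 1
      have h1 := le_nextFree (occupied (l.filter (k < ·))) a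
      refine nextFree_eq h1 ?_ fun y hy hy' =>
        Finset.mem_union_left _ (mem_of_lt_nextFree hy hy')
      rw [Finset.mem_union, not_or]
      refine ⟨nextFree_notMem _ _, fun hm => ?_⟩
      have := lt_of_mem_occupied_of_notMem (hlt hk.2) h hm
      omega
    · have hne := hk.1
      rw [List.filter_cons_of_pos (by simpa using hka), occupied_cons, Finset.mem_insert,
        not_or] at h
      rw [List.filter_cons_of_pos (p := fun x => decide (¬ k < x)) (by simpa using hka),
        List.filter_cons_of_neg (by simpa using hka), occupied_cons, occupied_cons, ih hk.2 h.2,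
        Finset.union_insert]
      congr 1
      have h1 : nextFree (occupied (l.filter (¬ k < ·))) a ≤ k := nextFree_le hka h.2
      refine nextFree_eq (le_nextFree _ _) ?_ fun y hy hy' =>
        Finset.mem_union_right _ (mem_of_lt_nextFree hy hy')
      rw [Finset.mem_union, not_or]
      refine ⟨fun hm => ?_, nextFree_notMem _ _⟩
      have := hhi _ hm
      omega

/-- The largest spot among `1, …, n` that is not in `B`, or `0` if there is none. -/
def lastFree (n : ℕ) (B : Finset ℕ) : ℕ := (Finset.Ioc 0 n \ B).sup id

theorem lastFree_eq_iff {n k : ℕ} {B : Finset ℕ} (hk : k ∈ Finset.Ioc 0 n) :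
    lastFree n B = k ↔ k ∉ B ∧ Finset.Ioc k n ⊆ B := by
  rw [Finset.mem_Ioc] at hk
  constructor
  · rintro rfl
    constructor
    · have hne : (Finset.Ioc 0 n \ B).Nonempty := by
        rw [Finset.nonempty_iff_ne_empty]
        intro h
        simp [lastFree, h] at hk
      obtain ⟨x, hx, hx'⟩ := Finset.exists_mem_eq_sup _ hne id
      rw [lastFree, hx']
      exact (Finset.mem_sdiff.mp hx).2
    · intro x hx
      rw [Finset.mem_Ioc] at hx
      by_contra hB
      have hm : x ∈ Finset.Ioc 0 n \ B := by simp [hB]; omega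
      have : x ≤ lastFree n B := Finset.le_sup (f := id) hm
      omega
  · rintro ⟨h1, h2⟩
    refine le_antisymm (Finset.sup_le fun x hx => ?_) (Finset.le_sup (f := id) (by simp [h1]; omega))
    simp only [Finset.mem_sdiff, Finset.mem_Ioc] at hx
    by_contra! h
    exact hx.2 (h2 (Finset.mem_Ioc.mpr ⟨h, hx.1.2⟩))

theorem lastFree_le (n : ℕ) (B : Finset ℕ) : lastFree n B ≤ n :=
  Finset.sup_le fun x hx => by simp at hx; exact hx.1.2

theorem lastFree_pos {n : ℕ} {B : Finset ℕ} (h : B.card < n) : 0 < lastFree n B := by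
  obtain ⟨x, hx, hB⟩ := Finset.exists_mem_notMem_of_card_lt_card (s := B) (t := Finset.Ioc 0 n)
    (by simpa using h)
  have : x ≤ lastFree n B := Finset.le_sup (f := id) (by simpa [hB] using hx)
  rw [Finset.mem_Ioc] at hx
  omega

theorem occupied_split_iff {n k : ℕ} (hk : k ∈ Finset.Ioc 0 n) {l : List ℕ}
    (hl : ∀ x ∈ l, x ∈ Finset.Ioc 0 n) (hkl : k ∉ l) :
    (occupied l ⊆ Finset.Ioc 0 n ∧ lastFree n (occupied l) = k) ↔
      (l.filter (k < ·)).length = n - k ∧ occupied (l.filter (k < ·)) ⊆ Finset.Ioc k n ∧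
        occupied (l.filter (¬ k < ·)) ⊆ Finset.Ioc 0 (k - 1) := by
  rw [lastFree_eq_iff hk, Finset.mem_Ioc] at *
  have hlo : ∀ a ∈ l.filter (¬ k < ·), a < k := by
    intro a ha
    simp only [List.mem_filter, decide_not, Bool.not_eq_true', decide_eq_false_iff_not] at ha
    have : a ≠ k := fun e => hkl (e ▸ ha.1)
    omega
  have hhi : ∀ x ∈ occupied (l.filter (k < ·)), k < x := fun x hx =>
    lt_of_mem_occupied (fun a ha => by simpa using (List.mem_filter.mp ha).2) hx
  have hpos : ∀ x ∈ occupied l, 0 < x := fun x hx =>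
    lt_of_mem_occupied (fun a ha => (Finset.mem_Ioc.mp (hl a ha)).1) hx
  constructor
  · rintro ⟨h1, h2, h3⟩
    have hkL : k ∉ occupied (l.filter (¬ k < ·)) := fun h => h2 (occupied_filter_subset _ _ h)
    have hu := occupied_eq_union hkl hkL
    have hsub : occupied (l.filter (k < ·)) ⊆ Finset.Ioc k n := fun x hx =>
      Finset.mem_Ioc.mpr ⟨hhi x hx, (Finset.mem_Ioc.mp (h1 (occupied_filter_subset _ _ hx))).2⟩
    have heq : occupied (l.filter (k < ·)) = Finset.Ioc k n := by
      refine hsub.antisymm fun x hx => ?_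
      have hx' := h3 hx
      rw [hu, Finset.mem_union] at hx'
      refine hx'.resolve_right fun h => ?_
      have := lt_of_mem_occupied_of_notMem hlo hkL h
      rw [Finset.mem_Ioc] at hx
      omega
    refine ⟨by rw [← card_occupied, heq, Nat.card_Ioc], hsub, fun x hx => ?_⟩
    have := lt_of_mem_occupied_of_notMem hlo hkL hx
    have := hpos x (occupied_filter_subset _ _ hx)
    rw [Finset.mem_Ioc]
    omega
  · rintro ⟨h1, h2, h3⟩
    have hkL : k ∉ occupied (l.filter (¬ k < ·)) := fun h => by
      have := Finset.mem_Ioc.mp (h3 h)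
      omega
    have heq : occupied (l.filter (k < ·)) = Finset.Ioc k n :=
      Finset.eq_of_subset_of_card_le h2 (by rw [card_occupied, h1, Nat.card_Ioc])
    rw [occupied_eq_union hkl hkL, heq]
    refine ⟨Finset.union_subset ?_ ?_, ?_, Finset.subset_union_left⟩
    · exact Finset.Ioc_subset_Ioc_left (Nat.zero_le _)
    · exact h3.trans (Finset.Ioc_subset_Ioc_right (by omega))
    · rw [Finset.mem_union, not_or, Finset.mem_Ioc]
      exact ⟨fun h => lt_irrefl _ h.1, hkL⟩

theorem sum_lastFree_eq {n k : ℕ} (hk : k ∈ Finset.Ioc 0 n) (N : ℕ) (w : Finset ℕ → ℕ) :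
    (∑ l ∈ words (Finset.Ioc 0 n) N,
      if occupied l ⊆ Finset.Ioc 0 n ∧ lastFree n (occupied l) = k then
        w (occupied l ∩ Finset.Iio k) else 0) =
      N.choose (n - k) *
        (∑ l ∈ words (Finset.Ioc k n) (n - k), if occupied l ⊆ Finset.Ioc k n then 1 else 0) *
        ∑ l ∈ words (Finset.Ioc 0 (k - 1)) (N - (n - k)),
          if occupied l ⊆ Finset.Ioc 0 (k - 1) then w (occupied l) else 0 := by
  have hk' := Finset.mem_Ioc.mp hk
  have hdisj : Disjoint (Finset.Ioc k n) (Finset.Ioc 0 (k - 1)) := by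
    rw [Finset.disjoint_left]
    intro x hx hx'
    rw [Finset.mem_Ioc] at hx hx'
    omega
  have hmem : ∀ x, x ∈ Finset.Ioc k n ∪ Finset.Ioc 0 (k - 1) ↔ x ∈ Finset.Ioc 0 n ∧ x ≠ k := by
    intro x
    simp only [Finset.mem_union, Finset.mem_Ioc]
    omega
  rw [← sum_words_shuffle hdisj]
  symm
  refine Finset.sum_subset_zero_on_sdiff
    (words_mono (fun x hx => ((hmem x).mp hx).1) N) (fun l hl => if_neg ?_) fun l hl => ?_
  · rintro ⟨-, h⟩
    rw [lastFree_eq_iff hk] at h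
    rw [Finset.mem_sdiff, mem_words, mem_words] at hl
    refine hl.2 ⟨hl.1.1, fun x hx => (hmem x).mpr ⟨hl.1.2 x hx, ?_⟩⟩
    rintro rfl
    exact h.1 (mem_occupied_of_mem hx)
  · rw [mem_words] at hl
    have hkl : k ∉ l := fun h => ((hmem k).mp (hl.2 k h)).2 rfl
    have hl0 : ∀ x ∈ l, x ∈ Finset.Ioc 0 n := fun x hx => ((hmem x).mp (hl.2 x hx)).1
    have e1 : l.filter (· ∈ Finset.Ioc k n) = l.filter (k < ·) :=
      List.filter_congr fun x hx => by
        have := Finset.mem_Ioc.mp (hl0 x hx)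
        simp [this.2]
    have e2 : l.filter (· ∉ Finset.Ioc k n) = l.filter (¬ k < ·) :=
      List.filter_congr fun x hx => by
        have := Finset.mem_Ioc.mp (hl0 x hx)
        simp [this.2]
    rw [e1, e2]
    have hiff := occupied_split_iff hk hl0 hkl
    by_cases hc : occupied l ⊆ Finset.Ioc 0 n ∧ lastFree n (occupied l) = k
    · obtain ⟨h1, h2, h3⟩ := hiff.mp hc
      rw [if_pos hc, if_pos h1, if_pos h2, if_pos h3, one_mul]
      congr 1
      have hkL : k ∉ occupied (l.filter (¬ k < ·)) := fun h => by
        have := Finset.mem_Ioc.mp (h3 h)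
        omega
      ext x
      rw [occupied_eq_union hkl hkL, Finset.mem_inter, Finset.mem_union, Finset.mem_Iio]
      constructor
      · intro h
        have := Finset.mem_Ioc.mp (h3 h)
        exact ⟨Or.inr h, by omega⟩
      · rintro ⟨h | h, hx⟩
        · have := Finset.mem_Ioc.mp (h2 h)
          omega
        · exact h
    · rw [if_neg hc]
      split_ifs with h1 h2 h3
      · exact absurd (hiff.mpr ⟨h1, h2, h3⟩) hc
      all_goals simp

/-- The number of preference lists of `m` cars for the spots `lo + 1, …, lo + n` under which
all cars park, when no car leaves. -/
noncomputable def parkCount (lo n m : ℕ) : ℕ :=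
  ∑ l ∈ words (Finset.Ioc lo (lo + n)) m, if occupied l ⊆ Finset.Ioc lo (lo + n) then 1 else 0

theorem words_zero (U : Finset ℕ) : words U 0 = {[]} := rfl

theorem parkCount_zero (lo n : ℕ) : parkCount lo n 0 = 1 := by
  rw [parkCount, words_zero, Finset.sum_singleton, if_pos (by simp)]

theorem parkCount_eq_zero {lo n m : ℕ} (h : n < m) : parkCount lo n m = 0 := by
  refine Finset.sum_eq_zero fun l hl => if_neg fun hs => ?_
  have := Finset.card_le_card hs
  rw [card_occupied, (mem_words.mp hl).1, Nat.card_Ioc] at this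
  omega

theorem sum_words_singleton (a i : ℕ) : ∑ _l ∈ words {a} i, 1 = 1 := by
  induction i with
  | zero => simp [words_zero]
  | succ i ih => rw [sum_words_succ]; simpa using ih

theorem occupied_append_subset {lo hi : ℕ} {e l : List ℕ} (he : ∀ x ∈ e, x = lo + 1)
    (h : e.length + l.length ≤ hi - lo) (hl : occupied l ⊆ Finset.Ioc lo hi) :
    occupied (e ++ l) ⊆ Finset.Ioc lo hi := by
  induction e with
  | nil => exact hl
  | cons a e ih =>
    rw [List.length_cons] at h
    have ih' := ih (fun x hx => he x (List.mem_cons_of_mem _ hx)) (by omega)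
    obtain ⟨x, hx, hB⟩ := Finset.exists_mem_notMem_of_card_lt_card
      (s := occupied (e ++ l)) (t := Finset.Ioc lo hi) (by
        rw [card_occupied, Nat.card_Ioc, List.length_append]
        omega)
    rw [Finset.mem_Ioc] at hx
    obtain rfl := he a (by simp)
    rw [List.cons_append, occupied_cons, Finset.insert_subset_iff, Finset.mem_Ioc]
    exact ⟨⟨le_nextFree _ _, (nextFree_le hx.1 hB).trans hx.2⟩, ih'⟩

theorem occupied_subset_Ioc_succ_iff {lo hi : ℕ} {l : List ℕ} (hl : ∀ x ∈ l, lo < x) :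
    occupied l ⊆ Finset.Ioc lo hi ↔
      l.length ≤ hi - lo ∧ occupied (l.filter (· ≠ lo + 1)) ⊆ Finset.Ioc (lo + 1) hi := by
  constructor
  · intro h
    refine ⟨?_, fun x hx => ?_⟩
    · rw [← card_occupied, ← Nat.card_Ioc]
      exact Finset.card_le_card h
    · have h1 := Finset.mem_Ioc.mp (h (occupied_filter_subset _ _ hx))
      refine Finset.mem_Ioc.mpr ⟨lt_of_mem_occupied (fun a ha => ?_) hx, h1.2⟩
      have h2 := List.mem_filter.mp ha
      have := hl a h2.1
      simp only [ne_eq, decide_not, Bool.not_eq_true', decide_eq_false_iff_not] at h2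
      omega
  · rintro ⟨h1, h2⟩
    have hp : (l.filter (· = lo + 1) ++ l.filter (· ≠ lo + 1)).Perm l := by
      simpa using List.filter_append_perm (· = lo + 1) l
    rw [← occupied_perm hp]
    rw [← hp.length_eq, List.length_append] at h1
    have he : ∀ x ∈ l.filter (· = lo + 1), x = lo + 1 := fun x hx => by
      simpa using (List.mem_filter.mp hx).2
    exact occupied_append_subset he h1 (h2.trans (Finset.Ioc_subset_Ioc_left (Nat.le_succ lo)))

theorem parkCount_succ {lo n m : ℕ} (h : m ≤ n + 1) :
    parkCount lo (n + 1) m =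
      ∑ i ∈ Finset.range (m + 1), m.choose i * parkCount (lo + 1) n (m - i) := by
  have hU : Finset.Ioc lo (lo + (n + 1)) = {lo + 1} ∪ Finset.Ioc (lo + 1) (lo + 1 + n) := by
    ext x
    simp only [Finset.mem_Ioc, Finset.mem_union, Finset.mem_singleton]
    omega
  have hd : Disjoint {lo + 1} (Finset.Ioc (lo + 1) (lo + 1 + n)) := by simp
  have key : ∀ i, m.choose i * parkCount (lo + 1) n (m - i) =
      ∑ l ∈ words ({lo + 1} ∪ Finset.Ioc (lo + 1) (lo + 1 + n)) m,
        if (l.filter (· ∈ ({lo + 1} : Finset ℕ))).length = i then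
          1 * (if occupied (l.filter (· ∉ ({lo + 1} : Finset ℕ))) ⊆
            Finset.Ioc (lo + 1) (lo + 1 + n) then 1 else 0) else 0 := fun i => by
    rw [sum_words_shuffle hd m i (fun _ => 1)
      (fun l => if occupied l ⊆ Finset.Ioc (lo + 1) (lo + 1 + n) then 1 else 0),
      sum_words_singleton, mul_one, parkCount]
  simp only [key]
  rw [Finset.sum_comm, parkCount, ← hU]
  refine Finset.sum_congr rfl fun l hl => ?_
  rw [mem_words] at hl
  have hr : (l.filter (· ∈ ({lo + 1} : Finset ℕ))).length ∈ Finset.range (m + 1) := by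
    rw [Finset.mem_range, Nat.lt_succ_iff, ← hl.1]
    exact List.length_filter_le _ _
  rw [Finset.sum_ite_eq, if_pos hr, one_mul]
  congr 1
  rw [occupied_subset_Ioc_succ_iff fun x hx => (Finset.mem_Ioc.mp (hl.2 x hx)).1]
  have : l.length ≤ lo + (n + 1) - lo := by omega
  rw [and_iff_right this]
  simp [add_assoc, add_comm 1 n]

theorem parkCount_cast {n m : ℕ} (lo : ℕ) (h : m ≤ n + 1) :
    (parkCount lo n m : ℤ) = (n + 1) ^ m - m * (n + 1) ^ (m - 1) := by
  induction n generalizing lo m with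
  | zero =>
    obtain rfl | rfl : m = 0 ∨ m = 1 := by omega
    · simp [parkCount_zero]
    · simp [parkCount_eq_zero]
  | succ n ih =>
    rcases h.eq_or_lt with rfl | h
    · rw [parkCount_eq_zero (by omega), pow_succ]
      push_cast
      ring
    · rw [parkCount_succ (by omega)]
      push_cast
      have e : ∀ i ∈ Finset.range (m + 1), (m.choose i : ℤ) * (parkCount (lo + 1) n (m - i) : ℤ) =
          1 ^ i * ((n : ℤ) + 1) ^ (m - i) * (m.choose i : ℤ) -
          ((m.choose i * (m - i) : ℕ) : ℤ) * ((n : ℤ) + 1) ^ (m - i - 1) := by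
        intro i hi
        rw [ih (lo + 1) (by omega)]
        push_cast
        ring
      rw [Finset.sum_congr rfl e, Finset.sum_sub_distrib, ← add_pow, add_comm (1 : ℤ)]
      congr 1
      cases m with
      | zero => simp
      | succ m =>
        rw [Finset.sum_range_succ, Nat.sub_self, mul_zero, Nat.cast_zero, zero_mul, add_zero,
          Nat.add_sub_cancel, add_comm ((n : ℤ) + 1) 1, add_pow, Finset.mul_sum]
        refine Finset.sum_congr rfl fun i hi => ?_
        rw [Finset.mem_range] at hi
        have h1 := Nat.choose_mul_succ_eq m i
        rw [← h1, show m + 1 - i - 1 = m - i by omega]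
        push_cast
        ring

theorem parkCount_of_pos {n m : ℕ} (lo : ℕ) (hm : 0 < m) (h : m ≤ n + 1) :
    parkCount lo n m = (n + 1 - m) * (n + 1) ^ (m - 1) := by
  zify [h]
  rw [parkCount_cast lo h]
  obtain ⟨m, rfl⟩ := Nat.exists_eq_succ_of_ne_zero hm.ne'
  simp only [Nat.succ_eq_add_one, Nat.add_sub_cancel]
  push_cast
  ring

theorem parkCount_self (lo n : ℕ) : parkCount lo n n = (n + 1) ^ (n - 1) := by
  rcases Nat.eq_zero_or_pos n with rfl | h
  · simp [parkCount_zero]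
  · rw [parkCount_of_pos lo h (by omega), Nat.add_sub_cancel_left, one_mul]

theorem head?_filter_range' (n x : ℕ) (occ : List ℕ) :
    ((List.range' x (n + 1 - x)).filter (fun s => decide (s ∉ occ))).head? =
      if nextFree occ.toFinset x ≤ n then some (nextFree occ.toFinset x) else none := by
  have h1 := le_nextFree occ.toFinset x
  have h2 := nextFree_notMem occ.toFinset x
  rw [List.mem_toFinset] at h2
  rw [List.head?_filter]
  split_ifs with h
  · rw [List.find?_range'_eq_some]
    refine ⟨by simpa using h2, by rw [List.mem_range'_1]; omega, fun j hj hj' => ?_⟩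
    simpa using mem_of_lt_nextFree hj hj'
  · rw [List.find?_range'_eq_none]
    intro y hy hy'
    have := mem_of_lt_nextFree (B := occ.toFinset) (a := x) (x := y) hy (by omega)
    simpa using this

theorem parkStep_map_some (n t x : ℕ) (sp : List ℕ) :
    parkStep n t (sp.map some) x = sp.map some ++
      [if nextFree (sp.drop (sp.length - t)).toFinset x ≤ n then
        some (nextFree (sp.drop (sp.length - t)).toFinset x) else none] := by
  rw [parkStep, head?_filter_range']
  simp [← List.map_drop]

theorem parkOutcome_concat (n t x : ℕ) (l : List ℕ) :
    parkOutcome n t (l ++ [x]) = parkStep n t (parkOutcome n t l) x := by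
  simp [parkOutcome]

theorem subset_parkStep (n t x : ℕ) (prev : List (Option ℕ)) : prev ⊆ parkStep n t prev x :=
  List.subset_append_left _ _

/-- As long as no car has left, the metered scheme agrees with the classical one. -/
theorem parkOutcome_cons_eq_map {n t a : ℕ} {b : List ℕ} (hb : b.length ≤ t)
    (h : ∀ x ∈ occupied (a :: b), x ≤ n) :
    ∃ sp : List ℕ, sp.length = b.length ∧ (a :: sp).Nodup ∧
      (a :: sp).toFinset = occupied (a :: b) ∧
      parkOutcome n t (a :: b) = (a :: sp).map some := by
  induction b using List.reverseRecOn with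
  | nil =>
    have h0 : nextFree ∅ a = a := nextFree_eq le_rfl (by simp) (by omega)
    have han : a ≤ n := h a (mem_occupied_of_mem (by simp))
    refine ⟨[], rfl, by simp, by simp [occupied_cons, h0], ?_⟩
    have := parkStep_map_some n t a []
    simpa [h0, han, parkOutcome] using this
  | append_singleton b x ih =>
    rw [List.length_append, List.length_singleton] at hb
    rw [← List.cons_append, occupied_concat] at h ⊢
    obtain ⟨sp, h1, h2, h3, h4⟩ := ih (by omega)
      fun y hy => h y (Finset.mem_insert_of_mem hy)
    have hx := h _ (Finset.mem_insert_self _ _)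
    refine ⟨sp ++ [nextFree (occupied (a :: b)) x], by simp [h1], ?_, ?_, ?_⟩
    · rw [← List.cons_append]
      refine List.nodup_append.mpr ⟨h2, by simp, fun y hy z hz => ?_⟩
      rw [List.mem_singleton] at hz
      rintro rfl
      rw [← List.mem_toFinset, h3, hz] at hy
      exact nextFree_notMem _ _ hy
    · rw [← List.cons_append, List.toFinset_append, h3, Finset.insert_eq, Finset.union_comm]
      simp
    · rw [parkOutcome_concat, h4, parkStep_map_some, List.length_cons, h1,
        Nat.sub_eq_zero_of_le (by omega), List.drop_zero, h3, if_pos hx]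
      simp

theorem forall_isSome_parkOutcome_iff {n t a : ℕ} {b : List ℕ} (hb : b.length ≤ t) :
    (∀ o ∈ parkOutcome n t (a :: b), o.isSome) ↔ ∀ x ∈ occupied (a :: b), x ≤ n := by
  constructor
  · intro h
    induction b using List.reverseRecOn with
    | nil =>
      have h0 : nextFree ∅ a = a := nextFree_eq le_rfl (by simp) (by omega)
      have := parkStep_map_some n t a []
      simp only [parkOutcome, List.foldl_cons, List.foldl_nil] at h
      rw [← List.map_nil (f := some), this] at h
      simpa [h0, occupied_cons] using h
    | append_singleton b x ih =>
      rw [List.length_append, List.length_singleton] at hb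
      rw [← List.cons_append, parkOutcome_concat] at h
      have ih' := ih (by omega) fun o ho => h o (subset_parkStep _ _ _ _ ho)
      obtain ⟨sp, h1, -, h3, h4⟩ := parkOutcome_cons_eq_map (t := t) (by omega) ih'
      rw [h4, parkStep_map_some, List.length_cons, h1, Nat.sub_eq_zero_of_le (by omega),
        List.drop_zero, h3] at h
      have hx := h _ (List.mem_append_right _ (List.mem_singleton_self _))
      rw [← List.cons_append, occupied_concat, Finset.forall_mem_insert]
      exact ⟨by by_contra hn; simp [hn] at hx, ih'⟩
  · intro h o ho
    obtain ⟨sp, -, -, -, h4⟩ := parkOutcome_cons_eq_map hb h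
    rw [h4, List.mem_map] at ho
    obtain ⟨y, -, rfl⟩ := ho
    rfl

theorem meteredPF_cons_concat_iff {n t a c : ℕ} {b : List ℕ} (hb : b ∈ words (Finset.Ioc 0 n) t)
    (ha : a ∈ Finset.Ioc 0 n) (hc : c ∈ Finset.Ioc 0 n) :
    MeteredPF (t + 2) n t (a :: (b ++ [c])) ↔
      occupied b ⊆ Finset.Ioc 0 n ∧ nextFree (occupied b) a ≤ n ∧
        nextFree ((insert (nextFree (occupied b) a) (occupied b)).erase a) c ≤ n := by
  rw [mem_words] at hb
  have hlen : (a :: (b ++ [c])).length = t + 2 := by simp [hb.1]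
  have hpref : ∀ x ∈ a :: (b ++ [c]), x ∈ Finset.Icc 1 n := by
    intro x hx
    simp only [List.mem_cons, List.mem_append, List.not_mem_nil, or_false] at hx
    rcases hx with rfl | hx | rfl
    exacts [ha, hb.2 x hx, hc]
  have hsub : occupied b ⊆ Finset.Ioc 0 n ↔ ∀ x ∈ occupied b, x ≤ n :=
    ⟨fun h x hx => (Finset.mem_Ioc.mp (h hx)).2, fun h x hx => Finset.mem_Ioc.mpr
      ⟨lt_of_mem_occupied (fun y hy => (Finset.mem_Ioc.mp (hb.2 y hy)).1) hx, h x hx⟩⟩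
  have hfst : (occupied b ⊆ Finset.Ioc 0 n ∧ nextFree (occupied b) a ≤ n) ↔
      ∀ x ∈ occupied (a :: b), x ≤ n := by
    rw [occupied_cons, Finset.forall_mem_insert, hsub, and_comm]
  rw [← and_assoc, hfst, MeteredPF, and_iff_right hlen, and_iff_right hpref,
    ← forall_isSome_parkOutcome_iff hb.1.le, ← List.cons_append, parkOutcome_concat]
  have hstep : (∀ o ∈ parkOutcome n t (a :: b), o.isSome) →
      ((∀ o ∈ parkStep n t (parkOutcome n t (a :: b)) c, o.isSome) ↔
        nextFree ((insert (nextFree (occupied b) a) (occupied b)).erase a) c ≤ n) := by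
    intro h
    obtain ⟨sp, h1, h2, h3, h4⟩ :=
      parkOutcome_cons_eq_map hb.1.le ((forall_isSome_parkOutcome_iff hb.1.le).mp h)
    have hsp : sp.toFinset = (insert (nextFree (occupied b) a) (occupied b)).erase a := by
      rw [← occupied_cons, ← h3, List.toFinset_cons, Finset.erase_insert]
      simpa using (List.nodup_cons.mp h2).1
    rw [h4] at h ⊢
    rw [parkStep_map_some, List.length_cons, h1, hb.1, Nat.add_sub_cancel_left, List.drop_one,
      List.tail_cons, hsp, List.forall_mem_append, and_iff_right h]
    simp only [List.mem_singleton, forall_eq]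
    split_ifs with hn <;> simp [hn]
  constructor
  · intro h
    have h' := fun o ho => h o (subset_parkStep _ _ _ _ ho)
    exact ⟨h', (hstep h').mp h⟩
  · rintro ⟨h, h'⟩
    exact (hstep h).mpr h'

theorem nextFree_le_iff {n c : ℕ} (B : Finset ℕ) (hc : 0 < c) :
    nextFree B c ≤ n ↔ c ≤ lastFree n B := by
  constructor
  · intro h
    have h1 := le_nextFree B c
    refine h1.trans (Finset.le_sup (f := id) ?_)
    exact Finset.mem_sdiff.mpr ⟨Finset.mem_Ioc.mpr ⟨hc.trans_le h1, h⟩, nextFree_notMem B c⟩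
  · intro h
    have hn := lastFree_le n B
    have := ((lastFree_eq_iff (Finset.mem_Ioc.mpr ⟨hc.trans_le h, hn⟩)).mp rfl).1
    exact (nextFree_le h this).trans hn

theorem lastFree_inter_Iio {n k : ℕ} (h : n < k) (B : Finset ℕ) :
    lastFree n (B ∩ Finset.Iio k) = lastFree n B := by
  unfold lastFree
  congr 1
  ext x
  simp only [Finset.mem_sdiff, Finset.mem_Ioc, Finset.mem_inter, Finset.mem_Iio]
  constructor
  · rintro ⟨h1, h2⟩
    exact ⟨h1, fun h3 => h2 ⟨h3, by omega⟩⟩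
  · rintro ⟨h1, h2⟩
    exact ⟨h1, fun h3 => h2 h3.1⟩

theorem Ioc_lastFree_subset (n : ℕ) (B : Finset ℕ) : Finset.Ioc (lastFree n B) n ⊆ B := by
  intro x hx
  rw [Finset.mem_Ioc] at hx
  by_contra hB
  have : x ≤ lastFree n B := Finset.le_sup (f := id) (by simp [hB]; omega)
  omega

theorem lastFree_erase_insert {n a : ℕ} {B : Finset ℕ} (ha : 0 < a) (hak : a ≤ lastFree n B) :
    lastFree n ((insert (nextFree B a) B).erase a) =
      if a ≤ lastFree (lastFree n B - 1) B then lastFree n B else a := by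
  have hkn := lastFree_le n B
  have hkB := (lastFree_eq_iff (Finset.mem_Ioc.mpr ⟨ha.trans_le hak, hkn⟩)).mp rfl
  have hsk := lastFree_le (lastFree n B - 1) B
  have hs := Ioc_lastFree_subset (lastFree n B - 1) B
  have hs' := fun h : 0 < lastFree (lastFree n B - 1) B =>
    (lastFree_eq_iff (Finset.mem_Ioc.mpr ⟨h, hsk⟩)).mp rfl
  set k := lastFree n B
  set s := lastFree (k - 1) B
  split_ifs with has
  · rw [lastFree_eq_iff (Finset.mem_Ioc.mpr ⟨by omega, hkn⟩)]
    have h1 : nextFree B a ≤ s := nextFree_le has (hs' (by omega)).1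
    constructor
    · simp only [Finset.mem_erase, Finset.mem_insert, hkB.1, or_false]
      omega
    · intro x hx
      rw [Finset.mem_erase]
      refine ⟨?_, Finset.mem_insert_of_mem (hkB.2 hx)⟩
      rw [Finset.mem_Ioc] at hx
      omega
  · rw [lastFree_eq_iff (Finset.mem_Ioc.mpr ⟨ha, hak.trans hkn⟩)]
    have h1 : nextFree B a = k := nextFree_eq hak hkB.1 fun y hy hy' =>
      hs (Finset.mem_Ioc.mpr ⟨by omega, by omega⟩)
    refine ⟨by simp, fun x hx => ?_⟩
    rw [Finset.mem_Ioc] at hx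
    rw [Finset.mem_erase, h1, Finset.mem_insert]
    refine ⟨by omega, ?_⟩
    rcases lt_trichotomy x k with h | h | h
    · exact Or.inr (hs (Finset.mem_Ioc.mpr ⟨by omega, by omega⟩))
    · exact Or.inl h
    · exact Or.inr (hkB.2 (Finset.mem_Ioc.mpr ⟨h, hx.2⟩))

theorem sum_Ioc_ite_add_choose (K : ℕ) {k s : ℕ} (h : s ≤ k) :
    (∑ a ∈ Finset.Ioc 0 k, if a ≤ s then K else a) + (s + 1).choose 2 =
      K * s + (k + 1).choose 2 := by
  induction k, h using Nat.le_induction with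
  | base =>
    rw [Finset.sum_congr rfl fun a ha => if_pos (Finset.mem_Ioc.mp ha).2]
    simp [mul_comm]
  | succ k hk ih =>
    rw [Finset.sum_Ioc_succ_top (Nat.zero_le k), if_neg (by omega), add_right_comm, ih,
      Nat.choose_succ_succ (k + 1) 1, Nat.choose_one_right]
    ring

theorem choose_two_le_mul {k s : ℕ} (h : s < k) : (s + 1).choose 2 ≤ k * s := by
  rw [Nat.choose_two_right, Nat.add_sub_cancel]
  exact (Nat.div_le_self _ _).trans (Nat.mul_le_mul_right s h)

theorem sum_Ioc_ite {k s : ℕ} (h : s < k) :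
    (∑ a ∈ Finset.Ioc 0 k, if a ≤ s then k else a) =
      (k + 1).choose 2 + (k * s - (s + 1).choose 2) := by
  have h1 := sum_Ioc_ite_add_choose k h.le
  have h2 := choose_two_le_mul h
  omega

theorem sum_ite_le (n k : ℕ) (h : k ≤ n) (f : ℕ → ℕ) :
    (∑ a ∈ Finset.Ioc 0 n, if a ≤ k then f a else 0) = ∑ a ∈ Finset.Ioc 0 k, f a := by
  rw [← Finset.sum_filter]
  congr 1
  ext x
  simp only [Finset.mem_filter, Finset.mem_Ioc]
  omega

/-- The number of admissible preferences of the first and the last car, when the cars in between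
occupy `B`. -/
theorem sum_first_last {n : ℕ} {B : Finset ℕ} (hB : 0 < lastFree n B) :
    (∑ a ∈ Finset.Ioc 0 n, ∑ c ∈ Finset.Ioc 0 n,
      if nextFree B a ≤ n ∧ nextFree ((insert (nextFree B a) B).erase a) c ≤ n then 1 else 0) =
      (lastFree n B + 1).choose 2 + (lastFree n B * lastFree (lastFree n B - 1) B -
        (lastFree (lastFree n B - 1) B + 1).choose 2) := by
  have hs := lastFree_le (lastFree n B - 1) B
  rw [← sum_Ioc_ite (by omega), ← sum_ite_le n _ (lastFree_le n B)]
  refine Finset.sum_congr rfl fun a ha => ?_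
  have ha0 := (Finset.mem_Ioc.mp ha).1
  simp only [nextFree_le_iff B ha0]
  split_ifs with h1 h2
  all_goals simp only [h1, true_and, false_and, if_false, Finset.sum_const_zero]
  all_goals
    rw [Finset.sum_congr rfl fun c hc =>
        if_congr (nextFree_le_iff _ (Finset.mem_Ioc.mp hc).1) rfl rfl,
      sum_ite_le n _ (lastFree_le n _), lastFree_erase_insert ha0 h1]
    simp [h2]

theorem sum_eq_sum_lastFree {n N : ℕ} (F : List ℕ → ℕ)
    (hF : ∀ l ∈ words (Finset.Ioc 0 n) N, lastFree n (occupied l) = 0 → F l = 0) :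
    (∑ l ∈ words (Finset.Ioc 0 n) N, if occupied l ⊆ Finset.Ioc 0 n then F l else 0) =
      ∑ k ∈ Finset.Ioc 0 n, ∑ l ∈ words (Finset.Ioc 0 n) N,
        if occupied l ⊆ Finset.Ioc 0 n ∧ lastFree n (occupied l) = k then F l else 0 := by
  rw [Finset.sum_comm]
  refine Finset.sum_congr rfl fun l hl => ?_
  split_ifs with h
  · simp only [h, true_and, Finset.sum_ite_eq, Finset.mem_Ioc, lastFree_le, and_true]
    split_ifs with h0
    · rfl
    · exact hF l hl (by omega)
  · simp [h]

theorem sum_secondFree (k N : ℕ) :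
    (∑ l ∈ words (Finset.Ioc 0 (k - 1)) N, if occupied l ⊆ Finset.Ioc 0 (k - 1) then
      (k + 1).choose 2 + (k * lastFree (k - 1) (occupied l) -
        (lastFree (k - 1) (occupied l) + 1).choose 2) else 0) =
      (k + 1).choose 2 * parkCount 0 (k - 1) N + ∑ s ∈ Finset.Ioc 0 (k - 1),
        N.choose (k - 1 - s) * (k - s) ^ (k - s - 2) *
          ((k * s - (s + 1).choose 2) * parkCount 0 (s - 1) (N - (k - 1 - s))) := by
  have h1 := sum_eq_sum_lastFree (n := k - 1) (N := N)
    (fun l => k * lastFree (k - 1) (occupied l) - (lastFree (k - 1) (occupied l) + 1).choose 2)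
    (fun l _ h => by simp [h])
  have hsplit : ∀ l, (if occupied l ⊆ Finset.Ioc 0 (k - 1) then
      (k + 1).choose 2 + (k * lastFree (k - 1) (occupied l) -
        (lastFree (k - 1) (occupied l) + 1).choose 2) else 0) =
      (k + 1).choose 2 * (if occupied l ⊆ Finset.Ioc 0 (k - 1) then 1 else 0) +
      if occupied l ⊆ Finset.Ioc 0 (k - 1) then (k * lastFree (k - 1) (occupied l) -
        (lastFree (k - 1) (occupied l) + 1).choose 2) else 0 := by
    intro l
    split_ifs <;> simp
  rw [Finset.sum_congr rfl fun l _ => hsplit l, Finset.sum_add_distrib, h1, ← Finset.mul_sum,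
    parkCount, zero_add]
  congr 1
  refine Finset.sum_congr rfl fun s hs => ?_
  have h2 := sum_lastFree_eq hs N fun _ => k * s - (s + 1).choose 2
  have hs' := Finset.mem_Ioc.mp hs
  have h3 := parkCount_self s (k - 1 - s)
  rw [parkCount, show s + (k - 1 - s) = k - 1 by omega, show k - 1 - s + 1 = k - s by omega,
    show k - 1 - s - 1 = k - s - 2 by omega] at h3
  rw [h3] at h2
  rw [parkCount, zero_add, Finset.mul_sum]
  simp only [mul_ite, mul_one, mul_zero]
  rw [← h2]
  refine Finset.sum_congr rfl fun l _ => ?_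
  split_ifs with h
  · rw [h.2]
  · rfl

theorem ncard_meteredPF (n t : ℕ) (h : t < n) :
    Set.ncard {l : List ℕ | MeteredPF (t + 2) n t l} =
      ∑ k ∈ Finset.Ioc 0 n, t.choose (n - k) * (n - k + 1) ^ (n - k - 1) *
        ((k + 1).choose 2 * parkCount 0 (k - 1) (t - (n - k)) + ∑ s ∈ Finset.Ioc 0 (k - 1),
          (t - (n - k)).choose (k - 1 - s) * (k - s) ^ (k - s - 2) *
            ((k * s - (s + 1).choose 2) *
              parkCount 0 (s - 1) (t - (n - k) - (k - 1 - s)))) := by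
  classical
  have hset : {l : List ℕ | MeteredPF (t + 2) n t l} =
      ((words (Finset.Ioc 0 n) (t + 2)).filter (MeteredPF (t + 2) n t) : Finset (List ℕ)) := by
    ext l
    simp only [Set.mem_ofPred_eq, Finset.coe_filter, mem_words]
    exact ⟨fun hl => ⟨⟨hl.1, hl.2.1⟩, hl⟩, fun hl => hl.2⟩
  rw [hset, Set.ncard_coe_finset, Finset.card_filter, sum_words_succ]
  have hgood : ∀ l ∈ words (Finset.Ioc 0 n) t, lastFree n (occupied l) ≠ 0 := fun l hl =>
    (lastFree_pos (by rw [card_occupied, (mem_words.mp hl).1]; exact h)).ne'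
  let w : ℕ → Finset ℕ → ℕ := fun k B =>
    (k + 1).choose 2 + (k * lastFree (k - 1) B - (lastFree (k - 1) B + 1).choose 2)
  calc
    _ = ∑ l ∈ words (Finset.Ioc 0 n) t, if occupied l ⊆ Finset.Ioc 0 n then
          w (lastFree n (occupied l)) (occupied l) else 0 := by
      simp only [sum_words_concat]
      rw [Finset.sum_comm]
      refine Finset.sum_congr rfl fun l hl => ?_
      have hw := sum_first_last (Nat.pos_of_ne_zero (hgood l hl))
      change _ = if _ then w _ _ else 0
      simp only [w]
      rw [← hw]
      have : ∀ a ∈ Finset.Ioc 0 n, ∀ c ∈ Finset.Ioc 0 n, _ := fun a ha c hc =>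
        meteredPF_cons_concat_iff hl ha hc
      rw [Finset.sum_congr rfl fun a ha => Finset.sum_congr rfl fun c hc =>
        if_congr (this a ha c hc) rfl rfl]
      split_ifs with h0 <;> simp [h0]
    _ = _ := by
      rw [sum_eq_sum_lastFree _ fun l hl h0 => absurd h0 (hgood l hl)]
      refine Finset.sum_congr rfl fun k hk => ?_
      have hk' := Finset.mem_Ioc.mp hk
      rw [← sum_secondFree, ← parkCount_self k (n - k), parkCount,
        show k + (n - k) = n by omega, ← sum_lastFree_eq hk t (w k)]
      refine Finset.sum_congr rfl fun l _ => ?_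
      split_ifs with h0
      · simp only [w, h0.2, lastFree_inter_Iio (show k - 1 < k by omega)]
      · rfl

theorem sum_Ioc_eq_add_sum_Icc {r N : ℕ} (hr : r ≤ N) {U : ℕ → ℕ} (h0 : r = 0 → U r = 0)
    (hU : ∀ s < r, U s = 0) :
    ∑ s ∈ Finset.Ioc 0 N, U s = U r + ∑ s ∈ Finset.Icc (r + 1) N, U s := by
  rcases Nat.eq_zero_or_pos r with rfl | hpos
  · rw [h0 rfl, zero_add]
    rfl
  · rw [← Finset.sum_insert (by simp)]
    symm
    refine Finset.sum_subset (fun s hs => ?_) fun s hs hs' => hU s ?_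
    all_goals
      simp only [Finset.mem_insert, Finset.mem_Icc, Finset.mem_Ioc] at *
      omega

theorem sum_secondFree_eq (r q : ℕ) :
    (∑ s ∈ Finset.Ioc 0 (r + q),
        q.choose (r + q - s) * (r + q + 1 - s) ^ (r + q + 1 - s - 2) *
          (((r + q + 1) * s - (s + 1).choose 2) * parkCount 0 (s - 1) (q - (r + q - s)))) =
      ((r + q + 1) * r - (r + 1).choose 2) * (q + 1) ^ (q - 1) +
        ∑ s ∈ Finset.Icc (r + 1) (r + q), (s * (r + q + 1) - (s + 1).choose 2) *
          q.choose (r + q - s) * r * s ^ (s - r - 1) * (r + q + 1 - s) ^ (r + q + 1 - s - 2) := by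
  rw [sum_Ioc_eq_add_sum_Icc (r := r) (by omega)]
  · congr 1
    · rw [show r + q - r = q by omega, show r + q + 1 - r = q + 1 by omega, Nat.choose_self,
        Nat.sub_self, parkCount_zero, show q + 1 - 2 = q - 1 by omega]
      ring
    · refine Finset.sum_congr rfl fun s hs => ?_
      rw [Finset.mem_Icc] at hs
      rw [parkCount_of_pos 0 (by omega) (by omega), show q - (r + q - s) = s - r by omega,
        show s - 1 + 1 = s by omega, show s - (s - r) = r by omega]
      rw [mul_comm s (r + q + 1)]
      ring
  · rintro rfl
    simp
  · intro s hs
    rw [Nat.choose_eq_zero_of_lt (by omega)]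
    simp

/-- For `2 < m ≤ n+1`, the number of `(m-2)`-metered `(m,n)`-parking
functions is
`(n-m+2)²(m-1)^{m-3} + Σ_{k=n-m+3}^{n} C(m-2,n-k)(n-k+1)^{n-k-1} ·
  [ C(k+1,2)(n-m+2)k^{m-n+k-3} + (k(n-m+1) - C(n-m+2,2))(k-n+m-1)^{k-n+m-3}
    + Σ_{j=n-m+2}^{k-1} (jk - C(j+1,2)) C(m-2-n+k, k-1-j)(n-m+1) j^{j+m-2-n}(k-j)^{k-j-2} ]`.
(Expressions like `n-m+2` are written `n+2-m` so that ℕ-subtraction agrees with the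
integer value; `1^{-1}` is interpreted as `1`, which is what ℕ-truncation gives.) -/
theorem mpf_m_minus_two_count (m n : ℕ) (h2 : 2 < m) (h3 : m ≤ n + 1) :
    Set.ncard {l : List ℕ | MeteredPF m n (m - 2) l} =
      (n + 2 - m) ^ 2 * (m - 1) ^ (m - 3) +
        ∑ k ∈ Finset.Icc (n + 3 - m) n,
          Nat.choose (m - 2) (n - k) * (n - k + 1) ^ (n - k - 1) *
            (Nat.choose (k + 1) 2 * (n + 2 - m) * k ^ (m + k - n - 3) +
             (k * (n + 1 - m) - Nat.choose (n + 2 - m) 2) *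
               (k + m - n - 1) ^ (k + m - n - 3) +
             ∑ j ∈ Finset.Icc (n + 2 - m) (k - 1),
               (j * k - Nat.choose (j + 1) 2) * Nat.choose (m + k - n - 2) (k - 1 - j) *
                 (n + 1 - m) * j ^ (j + m - n - 2) * (k - j) ^ (k - j - 2)) := by
  obtain ⟨t, rfl⟩ : ∃ t, m = t + 2 := ⟨m - 2, by omega⟩
  obtain ⟨r, rfl⟩ : ∃ r, n = t + 1 + r := ⟨n - (t + 1), by omega⟩
  rw [Nat.add_sub_cancel, ncard_meteredPF _ _ (by omega),
    sum_Ioc_eq_add_sum_Icc (r := r + 1) (by omega) (by omega),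
    show t + 1 + r + 3 - (t + 2) = r + 2 by omega,
    show t + 1 + r + 2 - (t + 2) = r + 1 by omega, show t + 2 - 1 = t + 1 by omega,
    show t + 2 - 3 = t - 1 by omega]
  · congr 1
    · have h := sum_secondFree_eq r 0
      rw [show t + 1 + r - (r + 1) = t by omega, Nat.choose_self, Nat.sub_self,
        Nat.add_sub_cancel, parkCount_zero]
      simp only [add_zero] at h
      rw [h, Finset.Icc_eq_empty (by omega), Finset.sum_empty, Nat.choose_succ_succ (r + 1) 1,
        Nat.choose_one_right]
      have h4 := choose_two_le_mul (Nat.lt_succ_self r)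
      have h5 : (r + 1) + (r + 1).choose 2 + ((r + 1) * r - (r + 1).choose 2) = (r + 1) ^ 2 := by
        rw [Nat.succ_eq_add_one] at h4
        rw [sq, mul_add, mul_one]
        omega
      rw [← h5]
      simp only [Nat.succ_eq_add_one, zero_add, one_pow, mul_one, add_zero, one_mul]
      exact mul_comm _ _
    · refine Finset.sum_congr rfl fun k hk => ?_
      rw [Finset.mem_Icc] at hk
      obtain ⟨q, rfl⟩ : ∃ q, k = r + q + 1 := ⟨k - r - 1, by omega⟩
      have h := sum_secondFree_eq r q
      rw [show t - (t + 1 + r - (r + q + 1)) = q by omega, Nat.add_sub_cancel, h,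
        parkCount_of_pos 0 (by omega) (by omega), show r + q + 1 - q = r + 1 by omega,
        show t + 1 + r + 1 - (t + 2) = r by omega,
        show t + 2 + (r + q + 1) - (t + 1 + r) - 3 = q - 1 by omega,
        show r + q + 1 + (t + 2) - (t + 1 + r) - 1 = q + 1 by omega,
        show r + q + 1 + (t + 2) - (t + 1 + r) - 3 = q - 1 by omega,
        show t + 2 + (r + q + 1) - (t + 1 + r) - 2 = q by omega,
        ← add_assoc, ← mul_assoc ((r + q + 1 + 1).choose 2)]
      congr 2
      refine Finset.sum_congr rfl fun j _ => ?_
      rw [show j + (t + 2) - (t + 1 + r) - 2 = j - r - 1 by omega]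
  · intro k hk
    rw [Nat.choose_eq_zero_of_lt (by omega)]
    simp
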